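/- arXiv:2408.09519 — 6 statements merged into one kernel-verified Lean document; each statement's English description precedes it below -/
import Mathlib

section
/- Let B and σ be positive-definite 3×3 complex Hermitian matrices and let v be any 3×3 complex Hermitian matrix. If (v, B×σ) = 0, then (B, v^#) ≤ 0, and equality holds if and only if v = 0. -/
open Matrix
open scoped ComplexOrder

/-- The trace pairing on 3×3 complex Hermitian matrices: `(x, y) = Re tr(x·y)`. -/
noncomputable def pairJ (x y : Matrix (Fin 3) (Fin 3) ℂ) : ℝ :=
  ((x * y).trace).re

/-- The Freudenthal cross product `x × y = (x+y)^# − x^# − y^#` on 3×3 matrices. -/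
noncomputable def crossJ (x y : Matrix (Fin 3) (Fin 3) ℂ) : Matrix (Fin 3) (Fin 3) ℂ :=
  (x + y).adjugate - x.adjugate - y.adjugate

theorem Matrix.PosDef.exists_unitary_diagonalization {n : Type*} [Fintype n] [DecidableEq n]
    {A : Matrix n n ℂ} (hA : A.PosDef) :
    ∃ (U : Matrix n n ℂ) (d : n → ℝ), U * Uᴴ = 1 ∧ (∀ i, 0 < d i) ∧
      A = U * diagonal (fun i => (d i : ℂ)) * Uᴴ := by
  refine ⟨hA.1.eigenvectorUnitary, hA.1.eigenvalues, ?_, hA.eigenvalues_pos, ?_⟩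
  · exact Unitary.coe_mul_star_self hA.1.eigenvectorUnitary
  · exact hA.1.spectral_theorem

/-- Two positive definite matrices are simultaneously diagonalized by congruence, the first
one to the identity. -/
theorem Matrix.PosDef.exists_simultaneous_diagonalization {n : Type*} [Fintype n] [DecidableEq n]
    {B σ : Matrix n n ℂ} (hB : B.PosDef) (hσ : σ.PosDef) :
    ∃ (P : Matrix n n ℂ) (d : n → ℝ), IsUnit P ∧ (∀ i, 0 < d i) ∧ B = P * Pᴴ ∧
      σ = P * diagonal (fun i => (d i : ℂ)) * Pᴴ := by
  obtain ⟨C, hC⟩ : ∃ C : Matrix n n ℂ, B = C * Cᴴ := by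
    open scoped MatrixOrder Matrix.Norms.L2Operator in
    obtain ⟨y, hy⟩ := CStarAlgebra.nonneg_iff_eq_star_mul_self.mp hB.posSemidef.nonneg
    exact ⟨yᴴ, by rw [hy, conjTranspose_conjTranspose, star_eq_conjTranspose]⟩
  have hCu : IsUnit C := by
    have hBu := hB.isUnit
    rw [isUnit_iff_isUnit_det, hC, det_mul] at hBu
    exact (isUnit_iff_isUnit_det C).2 (isUnit_of_mul_isUnit_left hBu)
  have hCdet := (isUnit_iff_isUnit_det C).1 hCu
  have hCHdet : IsUnit Cᴴ.det := (isUnit_iff_isUnit_det _).1 hCu.star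
  have hs : (C⁻¹ * σ * (C⁻¹)ᴴ).PosDef :=
    (IsUnit.posDef_star_right_conjugate_iff ((isUnit_nonsing_inv_iff).2 hCu)).2 hσ
  obtain ⟨U, d, hU, hd, hspec⟩ := hs.exists_unitary_diagonalization
  refine ⟨C * U, d, hCu.mul (IsUnit.of_mul_eq_one _ hU), hd, ?_, ?_⟩
  · rw [conjTranspose_mul, Matrix.mul_assoc, ← Matrix.mul_assoc U, hU, Matrix.one_mul, hC]
  · calc σ = C * (C⁻¹ * σ * (C⁻¹)ᴴ) * Cᴴ := by
          rw [conjTranspose_nonsing_inv, ← Matrix.mul_assoc, ← Matrix.mul_assoc,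
            mul_nonsing_inv _ hCdet, Matrix.one_mul, Matrix.mul_assoc,
            nonsing_inv_mul _ hCHdet, Matrix.mul_one]
      _ = _ := by
          rw [hspec, conjTranspose_mul]
          simp only [Matrix.mul_assoc]

theorem Matrix.trace_conj_mul_adjugate_conj {n R : Type*} [Fintype n] [DecidableEq n] [CommRing R]
    (P Q X Y : Matrix n n R) :
    (P * X * Q * (P * Y * Q).adjugate).trace = P.det * Q.det * (X * Y.adjugate).trace := by
  have hQ : P * X * Q * (P * Y * Q).adjugate =
      Q.det • (P * (X * Y.adjugate) * P.adjugate) := by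
    rw [adjugate_mul_distrib, adjugate_mul_distrib, ← Matrix.mul_assoc, Matrix.mul_assoc (P * X),
      mul_adjugate]
    simp only [Matrix.mul_assoc, Matrix.mul_smul, Matrix.smul_mul, Matrix.one_mul]
  rw [hQ, trace_smul, trace_mul_comm, ← Matrix.mul_assoc, adjugate_mul, Matrix.smul_mul,
    Matrix.one_mul, trace_smul, smul_eq_mul, smul_eq_mul]
  ring

theorem pairJ_conj_adjugate (P X Y : Matrix (Fin 3) (Fin 3) ℂ) :
    pairJ (P * X * Pᴴ) (P * Y * Pᴴ).adjugate = Complex.normSq P.det * pairJ X Y.adjugate := by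
  rw [pairJ, trace_conj_mul_adjugate_conj, det_conjTranspose, Complex.star_def, Complex.mul_conj,
    Complex.re_ofReal_mul, pairJ]

theorem pairJ_crossJ (x y z : Matrix (Fin 3) (Fin 3) ℂ) :
    pairJ x (crossJ y z) =
      pairJ x (y + z).adjugate - pairJ x y.adjugate - pairJ x z.adjugate := by
  simp [pairJ, crossJ, Matrix.mul_sub]

theorem pairJ_conj_crossJ (P X Y Z : Matrix (Fin 3) (Fin 3) ℂ) :
    pairJ (P * X * Pᴴ) (crossJ (P * Y * Pᴴ) (P * Z * Pᴴ)) =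
      Complex.normSq P.det * pairJ X (crossJ Y Z) := by
  rw [pairJ_crossJ, pairJ_crossJ, ← Matrix.add_mul, ← Matrix.mul_add, pairJ_conj_adjugate,
    pairJ_conj_adjugate, pairJ_conj_adjugate]
  ring

theorem pairJ_crossJ_one_diagonal (w : Matrix (Fin 3) (Fin 3) ℂ) (d : Fin 3 → ℝ) :
    pairJ w (crossJ 1 (diagonal fun i => (d i : ℂ))) =
      (w 0 0).re * (d 1 + d 2) + (w 1 1).re * (d 0 + d 2) + (w 2 2).re * (d 0 + d 1) := by
  simp [pairJ, crossJ, adjugate_fin_three, trace_fin_three, Matrix.mul_apply, Fin.sum_univ_three,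
    -adjugate_diagonal]
  ring

theorem pairJ_one_adjugate {w : Matrix (Fin 3) (Fin 3) ℂ} (hw : w.IsHermitian) :
    pairJ 1 w.adjugate =
      (w 0 0).re * (w 1 1).re + (w 1 1).re * (w 2 2).re + (w 2 2).re * (w 0 0).re
        - (Complex.normSq (w 0 1) + Complex.normSq (w 0 2) + Complex.normSq (w 1 2)) := by
  have him (i : Fin 3) : (w i i).im = 0 := Complex.conj_eq_iff_im.1 (hw.apply i i)
  rw [pairJ, Matrix.one_mul, adjugate_fin_three, trace_fin_three, ← hw.apply 1 0, ← hw.apply 2 0,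
    ← hw.apply 2 1]
  simp [him, Complex.normSq_apply]
  ring

/-- The second elementary symmetric function of three reals is nonpositive on the plane
orthogonal to a positive vector of the form `(b + c, a + c, a + b)`. -/
theorem esymm_two_nonpos_of_weighted_sum_eq_zero {a b c x y z : ℝ} (ha : 0 < a) (hb : 0 < b)
    (hc : 0 < c) (h : x * (b + c) + y * (a + c) + z * (a + b) = 0) :
    x * y + y * z + z * x ≤ 0 ∧
      (x * y + y * z + z * x = 0 → x = 0 ∧ y = 0 ∧ z = 0) := by
  have key : (b + c) * (x * y + y * z + z * x) =
      -(a * (y + z) ^ 2 + b * z ^ 2 + c * y ^ 2) := by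
    linear_combination (y + z) * h
  refine ⟨?_, fun h0 => ?_⟩
  · have : 0 ≤ a * (y + z) ^ 2 + b * z ^ 2 + c * y ^ 2 := by positivity
    by_contra! hpos
    have := mul_pos (add_pos hb hc) hpos
    linarith
  · rw [h0, mul_zero] at key
    have h1 : 0 ≤ a * (y + z) ^ 2 := by positivity
    have h2 : 0 ≤ b * z ^ 2 := by positivity
    have h3 : 0 ≤ c * y ^ 2 := by positivity
    have hz : z = 0 := by
      have : b * z ^ 2 = 0 := by linarith
      simpa [hb.ne'] using this
    have hy : y = 0 := by
      have : c * y ^ 2 = 0 := by linarith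
      simpa [hc.ne'] using this
    refine ⟨?_, hy, hz⟩
    simpa [hy, hz, (add_pos hb hc).ne'] using h

/-- The case `B = 1` and `σ` diagonal of the main theorem. -/
theorem pairJ_one_adjugate_nonpos {w : Matrix (Fin 3) (Fin 3) ℂ} (hw : w.IsHermitian)
    {d : Fin 3 → ℝ} (hd : ∀ i, 0 < d i)
    (h : pairJ w (crossJ 1 (diagonal fun i => (d i : ℂ))) = 0) :
    pairJ 1 w.adjugate ≤ 0 ∧ (pairJ 1 w.adjugate = 0 → w = 0) := by
  rw [pairJ_crossJ_one_diagonal] at h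
  obtain ⟨hle, heq⟩ := esymm_two_nonpos_of_weighted_sum_eq_zero (hd 0) (hd 1) (hd 2) h
  have n1 := Complex.normSq_nonneg (w 0 1)
  have n2 := Complex.normSq_nonneg (w 0 2)
  have n3 := Complex.normSq_nonneg (w 1 2)
  rw [pairJ_one_adjugate hw]
  refine ⟨by linarith, fun h0 => ?_⟩
  obtain ⟨hx, hy, hz⟩ := heq (by linarith)
  have h01 : w 0 1 = 0 := Complex.normSq_eq_zero.1 (by linarith)
  have h02 : w 0 2 = 0 := Complex.normSq_eq_zero.1 (by linarith)
  have h12 : w 1 2 = 0 := Complex.normSq_eq_zero.1 (by linarith)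
  have hdiag (i : Fin 3) (hi : (w i i).re = 0) : w i i = 0 :=
    Complex.ext hi (Complex.conj_eq_iff_im.1 (hw.apply i i))
  have h10 : w 1 0 = 0 := by rw [← hw.apply, h01, star_zero]
  have h20 : w 2 0 = 0 := by rw [← hw.apply, h02, star_zero]
  have h21 : w 2 1 = 0 := by rw [← hw.apply, h12, star_zero]
  ext i j
  fin_cases i <;> fin_cases j <;> simp [*]

/-- If `B`, `σ` are positive-definite 3×3 complex Hermitian matrices and `v` is Hermitian with
`(v, B×σ) = 0`, then `(B, v^#) ≤ 0`, with equality if and only if `v = 0`. -/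
theorem stmt0 (B σ v : Matrix (Fin 3) (Fin 3) ℂ)
    (hB : B.PosDef) (hσ : σ.PosDef) (hv : v.IsHermitian)
    (h : pairJ v (crossJ B σ) = 0) :
    pairJ B v.adjugate ≤ 0 ∧ (pairJ B v.adjugate = 0 ↔ v = 0) := by
  obtain ⟨P, d, hP, hd, rfl, rfl⟩ := hB.exists_simultaneous_diagonalization hσ
  have hPdet := (isUnit_iff_isUnit_det P).1 hP
  have hPHdet : IsUnit Pᴴ.det := (isUnit_iff_isUnit_det _).1 hP.star
  obtain ⟨w, hw, rfl⟩ : ∃ w : Matrix (Fin 3) (Fin 3) ℂ, w.IsHermitian ∧ v = P * w * Pᴴ := by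
    refine ⟨P⁻¹ * v * (P⁻¹)ᴴ, isHermitian_mul_mul_conjTranspose _ hv, ?_⟩
    rw [conjTranspose_nonsing_inv, ← Matrix.mul_assoc, ← Matrix.mul_assoc,
      mul_nonsing_inv _ hPdet, Matrix.one_mul, Matrix.mul_assoc,
      nonsing_inv_mul _ hPHdet, Matrix.mul_one]
  have hN : 0 < Complex.normSq P.det := Complex.normSq_pos.2 hPdet.ne_zero
  have hone : P * Pᴴ = P * 1 * Pᴴ := by rw [Matrix.mul_one]
  rw [hone, pairJ_conj_crossJ, mul_eq_zero, or_iff_right hN.ne'] at h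
  obtain ⟨hle, heq⟩ := pairJ_one_adjugate_nonpos hw hd h
  rw [hone, pairJ_conj_adjugate]
  refine ⟨mul_nonpos_of_nonneg_of_nonpos hN.le hle, fun h0 => ?_, fun h0 => ?_⟩
  · rw [heq ((mul_eq_zero.1 h0).resolve_left hN.ne'), Matrix.mul_zero, Matrix.zero_mul]
  · rw [← pairJ_conj_adjugate, h0]
    simp [pairJ]
end

section
/- For all 3×3 matrices B and y over a commutative ring, B × (adjugate(B) × y) = det(B)·y + tr(B·y)·adjugate(B). Consequently, when det(B) is invertible, the map y ↦ det(B)⁻¹·(adjugate(B)×y − ½ tr(B·y)·B) is a two-sided inverse of the map x ↦ B×x (in characteristic 0). -/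
open Matrix

/-- The Freudenthal cross product `x × y = adjugate(x+y) − adjugate(x) − adjugate(y)`
on 3×3 matrices over a commutative ring. -/
def cross3 {R : Type*} [CommRing R] (x y : Matrix (Fin 3) (Fin 3) R) :
    Matrix (Fin 3) (Fin 3) R :=
  (x + y).adjugate - x.adjugate - y.adjugate

section cross3

variable {R : Type*} [CommRing R] (B x y : Matrix (Fin 3) (Fin 3) R)

theorem cross3_eq_of :
    cross3 x y =
      !![x 1 1 * y 2 2 + y 1 1 * x 2 2 - x 1 2 * y 2 1 - y 1 2 * x 2 1,
         x 0 2 * y 2 1 + y 0 2 * x 2 1 - x 0 1 * y 2 2 - y 0 1 * x 2 2,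
         x 0 1 * y 1 2 + y 0 1 * x 1 2 - x 0 2 * y 1 1 - y 0 2 * x 1 1;
         x 1 2 * y 2 0 + y 1 2 * x 2 0 - x 1 0 * y 2 2 - y 1 0 * x 2 2,
         x 0 0 * y 2 2 + y 0 0 * x 2 2 - x 0 2 * y 2 0 - y 0 2 * x 2 0,
         x 0 2 * y 1 0 + y 0 2 * x 1 0 - x 0 0 * y 1 2 - y 0 0 * x 1 2;
         x 1 0 * y 2 1 + y 1 0 * x 2 1 - x 1 1 * y 2 0 - y 1 1 * x 2 0,
         x 0 1 * y 2 0 + y 0 1 * x 2 0 - x 0 0 * y 2 1 - y 0 0 * x 2 1,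
         x 0 0 * y 1 1 + y 0 0 * x 1 1 - x 0 1 * y 1 0 - y 0 1 * x 1 0] := by
  ext i j
  fin_cases i <;> fin_cases j <;> simp [cross3, adjugate_fin_three] <;> ring

theorem cross3_smul (c : R) : cross3 x (c • y) = c • cross3 x y := by
  ext i j
  fin_cases i <;> fin_cases j <;> simp [cross3_eq_of] <;> ring

theorem cross3_sub (z : Matrix (Fin 3) (Fin 3) R) :
    cross3 x (y - z) = cross3 x y - cross3 x z := by
  ext i j
  fin_cases i <;> fin_cases j <;> simp [cross3_eq_of] <;> ring

theorem cross3_self : cross3 x x = (2 : R) • x.adjugate := by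
  ext i j
  fin_cases i <;> fin_cases j <;> simp [cross3_eq_of, adjugate_fin_three] <;> ring

theorem trace_mul_fin_three :
    (x * y).trace =
      x 0 0 * y 0 0 + x 0 1 * y 1 0 + x 0 2 * y 2 0 +
        (x 1 0 * y 0 1 + x 1 1 * y 1 1 + x 1 2 * y 2 1) +
        (x 2 0 * y 0 2 + x 2 1 * y 1 2 + x 2 2 * y 2 2) := by
  simp only [trace_fin_three, mul_apply, Fin.sum_univ_three]

theorem cross3_cross3_adjugate :
    cross3 B (cross3 B.adjugate y) = B.det • y + (B * y).trace • B.adjugate := by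
  rw [trace_mul_fin_three]
  ext i j
  fin_cases i <;> fin_cases j <;>
    simp [cross3_eq_of, adjugate_fin_three, det_fin_three] <;> ring

theorem cross3_adjugate_cross3 :
    cross3 B.adjugate (cross3 B y) = B.det • y + (B.adjugate * y).trace • B := by
  rw [trace_mul_fin_three]
  ext i j
  fin_cases i <;> fin_cases j <;>
    simp [cross3_eq_of, adjugate_fin_three, det_fin_three] <;> ring

theorem trace_mul_cross3_self :
    (B * cross3 B y).trace = 2 * (B.adjugate * y).trace := by
  rw [trace_mul_fin_three, trace_mul_fin_three]
  simp [cross3_eq_of, adjugate_fin_three]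
  ring

end cross3

/-- For 3×3 matrices over a commutative ring,
`B × (adjugate(B) × y) = det(B)·y + tr(B·y)·adjugate(B)`.  Consequently, over a field of
characteristic zero with `det B` invertible, `y ↦ det(B)⁻¹·(adjugate(B)×y − ½ tr(B·y)·B)`
is a two-sided inverse of `x ↦ B×x`. -/
theorem stmt1 :
    (∀ (R : Type) [CommRing R] (B y : Matrix (Fin 3) (Fin 3) R),
      cross3 B (cross3 B.adjugate y) = B.det • y + (B * y).trace • B.adjugate) ∧
    (∀ (K : Type) [Field K] [CharZero K] (B : Matrix (Fin 3) (Fin 3) K), B.det ≠ 0 →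
      ∀ y : Matrix (Fin 3) (Fin 3) K,
        cross3 B (B.det⁻¹ • (cross3 B.adjugate y - (2⁻¹ * (B * y).trace) • B)) = y ∧
        B.det⁻¹ • (cross3 B.adjugate (cross3 B y) - (2⁻¹ * (B * cross3 B y).trace) • B) = y) := by
  refine ⟨fun R _ B y => cross3_cross3_adjugate B y, fun K _ _ B hB y => ⟨?_, ?_⟩⟩
  · rw [cross3_smul, cross3_sub, cross3_smul, cross3_self, cross3_cross3_adjugate, smul_smul,
      mul_right_comm, inv_mul_cancel₀ two_ne_zero, one_mul, add_sub_cancel_right,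
      inv_smul_smul₀ hB]
  · rw [trace_mul_cross3_self, inv_mul_cancel_left₀ two_ne_zero, cross3_adjugate_cross3,
      add_sub_cancel_right, inv_smul_smul₀ hB]
end

section
/- Let b, c be 3×3 complex Hermitian matrices and a, d ∈ ℝ. Then ((tr b) − d)² + (a − (tr c))² = a² + tr(b²) + tr(c²) + d² + 2(tr(adjugate b) − a·tr c) + 2(tr(adjugate c) − d·tr b), where all traces appearing are real numbers (traces of Hermitian matrices, of their squares, and of their adjugates are real). In particular, for u = (a,b,c,d) ∈ ℝ ⊕ J ⊕ J ⊕ ℝ one has |⟨u, r₀(i)⟩|² = ‖u‖² + 2(b^# − a·c, 1) + 2(c^# − d·b, 1). -/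
open Matrix

/-- For a 3×3 matrix over a commutative ring, the square of the trace is the trace of the square
plus twice the trace of the adjugate. -/
theorem Matrix.trace_sq_fin_three {R : Type*} [CommRing R] (A : Matrix (Fin 3) (Fin 3) R) :
    A.trace ^ 2 = (A * A).trace + 2 * A.adjugate.trace := by
  simp only [adjugate_fin_three, trace_fin_three, Matrix.mul_apply, Fin.sum_univ_three, of_apply,
    cons_val]
  ring

theorem Matrix.IsHermitian.im_trace_eq_zero {n : Type*} [Fintype n] {A : Matrix n n ℂ}
    (hA : A.IsHermitian) : A.trace.im = 0 := by
  rw [← Complex.conj_eq_iff_im, starRingEnd_apply, ← trace_conjTranspose, hA.eq]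

theorem Matrix.IsHermitian.re_trace_sq_fin_three {A : Matrix (Fin 3) (Fin 3) ℂ}
    (hA : A.IsHermitian) :
    A.trace.re ^ 2 = (A * A).trace.re + 2 * A.adjugate.trace.re := by
  have h := congrArg Complex.re (trace_sq_fin_three A)
  simpa [sq, hA.im_trace_eq_zero] using h

/-- For 3×3 complex Hermitian matrices `b`, `c` and reals `a`, `d`:
`((tr b) − d)² + (a − (tr c))² = a² + tr(b²) + tr(c²) + d²
  + 2(tr(adjugate b) − a·tr c) + 2(tr(adjugate c) − d·tr b)`,
where all traces are taken via their (automatically real) real parts.  This is the identity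
`|⟨u, r₀(i)⟩|² = ‖u‖² + 2(b^# − a·c, 1) + 2(c^# − d·b, 1)` for `u = (a,b,c,d)`. -/
theorem stmt2 (a d : ℝ) (b c : Matrix (Fin 3) (Fin 3) ℂ)
    (hb : b.IsHermitian) (hc : c.IsHermitian) :
    ((b.trace).re - d) ^ 2 + (a - (c.trace).re) ^ 2
      = a ^ 2 + ((b * b).trace).re + ((c * c).trace).re + d ^ 2
        + 2 * ((b.adjugate.trace).re - a * (c.trace).re)
        + 2 * ((c.adjugate.trace).re - d * (b.trace).re) := by
  linear_combination hb.re_trace_sq_fin_three + hc.re_trace_sq_fin_three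
end

section
/- For every real ν, the function y ↦ e^y · K_ν(y) is strictly decreasing on (0, ∞); that is, if 0 < y₁ < y₂ then e^{y₂} K_ν(y₂) < e^{y₁} K_ν(y₁). -/
open MeasureTheory

/-- The modified Bessel function of the second kind, defined for `ν ∈ ℝ` and `x > 0` by
`K_ν(x) = (1/2) ∫₁^∞ (t^ν + t^{−ν}) e^{−x(t+t⁻¹)/2} dt/t`. -/
noncomputable def besselK (ν x : ℝ) : ℝ :=
  (1 / 2) * ∫ t in Set.Ioi (1 : ℝ), (t ^ ν + t ^ (-ν)) * Real.exp (-(x * (t + t⁻¹)) / 2) / t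

/-- The integrand defining `besselK ν x` is integrable on `(1, ∞)` for `x > 0`. -/
lemma integrableOn_besselK_integrand (ν : ℝ) {x : ℝ} (hx : 0 < x) :
    IntegrableOn (fun t : ℝ => (t ^ ν + t ^ (-ν)) * Real.exp (-(x * (t + t⁻¹)) / 2) / t)
      (Set.Ioi 1) := by
  have hmaj : IntegrableOn (fun t : ℝ => 2 * (t ^ |ν| * Real.exp (-(x / 2) * t ^ (1 : ℝ))))
      (Set.Ioi 1) :=
    ((integrableOn_rpow_mul_exp_neg_mul_rpow (by linarith [abs_nonneg ν]) one_pos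
      (half_pos hx)).mono_set (Set.Ioi_subset_Ioi zero_le_one)).const_mul 2
  refine Integrable.mono' hmaj (Measurable.aestronglyMeasurable (by fun_prop)) ?_
  filter_upwards [ae_restrict_mem measurableSet_Ioi] with t ht
  have ht1 : 1 < t := ht
  have ht0 : 0 < t := one_pos.trans ht1
  rw [Real.norm_of_nonneg (by positivity), Real.rpow_one]
  have hsum : t ^ ν + t ^ (-ν) ≤ 2 * t ^ |ν| := by
    linarith [Real.rpow_le_rpow_of_exponent_le ht1.le (le_abs_self ν),
      Real.rpow_le_rpow_of_exponent_le ht1.le (neg_le_abs ν)]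
  have hexp : Real.exp (-(x * (t + t⁻¹)) / 2) ≤ Real.exp (-(x / 2) * t) := by
    apply Real.exp_le_exp.2
    have : 0 < x * t⁻¹ := by positivity
    linarith
  calc (t ^ ν + t ^ (-ν)) * Real.exp (-(x * (t + t⁻¹)) / 2) / t
      ≤ (t ^ ν + t ^ (-ν)) * Real.exp (-(x * (t + t⁻¹)) / 2) :=
        div_le_self (by positivity) ht1.le
    _ ≤ (2 * t ^ |ν|) * Real.exp (-(x / 2) * t) := by gcongr
    _ = 2 * (t ^ |ν| * Real.exp (-(x / 2) * t)) := by ring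

/-- For `t > 1`, the integrand of `besselK ν y` times `exp y` is strictly decreasing in `y`. -/
lemma exp_mul_besselK_integrand_lt (ν : ℝ) {y₁ y₂ t : ℝ} (hy : y₁ < y₂) (ht : 1 < t) :
    Real.exp y₂ * ((t ^ ν + t ^ (-ν)) * Real.exp (-(y₂ * (t + t⁻¹)) / 2) / t) <
      Real.exp y₁ * ((t ^ ν + t ^ (-ν)) * Real.exp (-(y₁ * (t + t⁻¹)) / 2) / t) := by
  have ht0 : 0 < t := one_pos.trans ht
  have key (y : ℝ) : Real.exp y * ((t ^ ν + t ^ (-ν)) * Real.exp (-(y * (t + t⁻¹)) / 2) / t) =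
      (t ^ ν + t ^ (-ν)) / t * Real.exp (-(y * (t + t⁻¹ - 2)) / 2) := by
    rw [show -(y * (t + t⁻¹ - 2)) / 2 = y + -(y * (t + t⁻¹)) / 2 by ring, Real.exp_add]
    ring
  have hgap : 0 < t + t⁻¹ - 2 := by
    rw [show t + t⁻¹ - 2 = (t - 1) ^ 2 / t by field_simp; ring]
    have : 0 < t - 1 := sub_pos.2 ht
    positivity
  rw [key, key]
  refine mul_lt_mul_of_pos_left (Real.exp_lt_exp.2 ?_) (by positivity)
  linarith [mul_lt_mul_of_pos_right hy hgap]

/-- For every real `ν`, the function `y ↦ e^y K_ν(y)` is strictly decreasing on `(0,∞)`. -/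
theorem stmt3 (ν : ℝ) :
    ∀ y₁ y₂ : ℝ, 0 < y₁ → y₁ < y₂ →
      Real.exp y₂ * besselK ν y₂ < Real.exp y₁ * besselK ν y₁ := by
  intro y₁ y₂ hy₁ hy
  have h₁ := (integrableOn_besselK_integrand ν hy₁).const_mul (Real.exp y₁)
  have h₂ := (integrableOn_besselK_integrand ν (hy₁.trans hy)).const_mul (Real.exp y₂)
  unfold besselK
  rw [mul_left_comm, mul_left_comm (Real.exp y₁), ← integral_const_mul (Real.exp y₂),
    ← integral_const_mul (Real.exp y₁)]
  refine mul_lt_mul_of_pos_left ?_ one_half_pos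
  rw [← sub_pos, ← integral_sub h₁ h₂]
  refine (setIntegral_pos_iff_support_of_nonneg_ae ?_ (h₁.sub h₂)).2 ?_
  · filter_upwards [ae_restrict_mem measurableSet_Ioi] with t ht
    exact sub_nonneg.2 (exp_mul_besselK_integrand_lt ν hy ht).le
  · rw [Set.inter_eq_right.2]
    · simp
    · exact fun t ht => (sub_pos.2 (exp_mul_besselK_integrand_lt ν hy ht)).ne'
end

section
/- There is a positive constant D_n depending only on n with the following property: for every quadratic form q on ℤⁿ taking integer values whose extension to ℝⁿ is positive definite, and every real number R ≥ 1, the set {v ∈ ℤⁿ : q(v) ≤ R} is finite and has cardinality at most D_n · R^{n/2}. -/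
/-- The parallelogram law bounds `Q (x - y)` for a nonnegative quadratic form `Q`. -/
theorem QuadraticMap.map_sub_le_two_mul_add {M : Type*} [AddCommGroup M] [Module ℝ M]
    (Q : QuadraticForm ℝ M) (hQ : ∀ x, 0 ≤ Q x) (x y : M) :
    Q (x - y) ≤ 2 * (Q x + Q y) := by
  have hadd := QuadraticMap.map_add Q x y
  have hsub := QuadraticMap.map_add Q x (-y)
  rw [QuadraticMap.polar_neg_right, QuadraticMap.map_neg, ← sub_eq_add_neg] at hsub
  have := hQ (x + y)
  linarith

/-- If a positive definite form takes integer values on `ℤⁿ`, then reduction modulo `m` is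
injective on the integer vectors with `q v ≤ R`, as soon as `4 * R < m ^ 2`. -/
theorem QuadraticMap.PosDef.injOn_intCast_zmod {n : ℕ} {q : QuadraticForm ℝ (Fin n → ℝ)}
    (hq : q.PosDef) (hint : ∀ v : Fin n → ℤ, ∃ k : ℤ, q (fun i => (v i : ℝ)) = (k : ℝ))
    {R : ℝ} {m : ℕ} (hm : 4 * R < (m : ℝ) ^ 2) :
    Set.InjOn (fun (v : Fin n → ℤ) i => (v i : ZMod m))
      {v : Fin n → ℤ | q (fun i => (v i : ℝ)) ≤ R} := by
  intro v hv w hw hvw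
  have hdvd : ∀ i, ∃ c : ℤ, v i - w i = m * c := fun i =>
    (ZMod.intCast_eq_intCast_iff_dvd_sub _ _ _).1 (congrFun hvw i).symm
  choose u hu using hdvd
  have hdiff : (fun i => (v i : ℝ)) - (fun i => (w i : ℝ)) = (m : ℝ) • fun i => (u i : ℝ) := by
    ext i
    simpa using congrArg (Int.cast : ℤ → ℝ) (hu i)
  have hle := q.map_sub_le_two_mul_add hq.nonneg (fun i => (v i : ℝ)) (fun i => (w i : ℝ))
  rw [hdiff, QuadraticMap.map_smul, smul_eq_mul] at hle
  simp only [Set.mem_ofPred_eq] at hv hw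
  by_contra hne
  have hu0 : (fun i => (u i : ℝ)) ≠ 0 := by
    intro h
    apply hne
    ext i
    have hi : u i = 0 := by simpa using congrFun h i
    have := hu i
    rw [hi, mul_zero] at this
    exact sub_eq_zero.1 this
  have hone : 1 ≤ q (fun i => (u i : ℝ)) := by
    obtain ⟨k, hk⟩ := hint u
    have hpos := hq _ hu0
    rw [hk] at hpos ⊢
    exact_mod_cast hpos
  nlinarith [mul_self_nonneg (m : ℝ)]

/-- Lattice-point counting: there is `D_n > 0` depending only on `n` such that for every
positive-definite quadratic form `q` on `ℝⁿ` taking integer values on `ℤⁿ` and every real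
`R ≥ 1`, the set `{v ∈ ℤⁿ : q(v) ≤ R}` is finite of cardinality at most `D_n · R^{n/2}`. -/
theorem stmt10 (n : ℕ) :
    ∃ D : ℝ, 0 < D ∧
      ∀ (q : QuadraticForm ℝ (Fin n → ℝ)), q.PosDef →
        (∀ v : Fin n → ℤ, ∃ k : ℤ, q (fun i => (v i : ℝ)) = (k : ℝ)) →
        ∀ R : ℝ, 1 ≤ R →
          ∃ hfin : {v : Fin n → ℤ | q (fun i => (v i : ℝ)) ≤ R}.Finite,
            (hfin.toFinset.card : ℝ) ≤ D * R ^ ((n : ℝ) / 2) := by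
  refine ⟨3 ^ n, by positivity, fun q hq hint R hR => ?_⟩
  have hR0 : 0 ≤ R := by linarith
  have hsqrt : 1 ≤ √R := Real.one_le_sqrt.2 hR
  set m := ⌊2 * √R⌋₊ + 1 with hm
  have hlt : 2 * √R < m := by
    rw [hm]
    exact_mod_cast Nat.lt_floor_add_one (2 * √R)
  have hle : (m : ℝ) ≤ 3 * √R := by
    have := Nat.floor_le (show 0 ≤ 2 * √R by positivity)
    rw [hm]
    push_cast
    linarith
  have hinj := hq.injOn_intCast_zmod hint (R := R) (m := m)
    (by nlinarith [Real.sq_sqrt hR0])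
  have hfin := Set.Finite.of_injOn (Set.mapsTo_univ _ _) hinj Set.finite_univ
  refine ⟨hfin, ?_⟩
  have hcard : hfin.toFinset.card ≤ m ^ n := by
    have := Finset.card_le_card_of_injOn (s := hfin.toFinset) (t := Finset.univ)
      (fun (v : Fin n → ℤ) i => (v i : ZMod m)) (fun _ _ => Finset.mem_coe.2 (Finset.mem_univ _))
      (by simpa only [Set.Finite.coe_toFinset] using hinj)
    simpa [ZMod.card] using this
  calc (hfin.toFinset.card : ℝ) ≤ (m : ℝ) ^ n := by exact_mod_cast hcard
    _ ≤ (3 * √R) ^ n := by gcongr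
    _ = 3 ^ n * R ^ ((n : ℝ) / 2) := by
      rw [mul_pow, Real.rpow_div_two_eq_sqrt _ hR0, Real.rpow_natCast]
end

section
/- Let Λ_C be a free ℤ-module of finite rank with a negative-definite quadratic form q₀ taking integer values on Λ_C, and assume Λ_C is maximal for q₀: any finitely generated ℤ-submodule Λ₁ with Λ_C ⊆ Λ₁ ⊆ Λ_C ⊗ ℚ and q₀(Λ₁) ⊆ ℤ equals Λ_C. Let Λ = ℤ ⊕ ℤ ⊕ Λ_C ⊕ ℤ ⊕ ℤ with quadratic form q(a₁,a₂,λ,d₂,d₁) = a₁d₁ + a₂d₂ + q₀(λ), and let Γ be the group of ℚ-linear automorphisms of Λ ⊗ ℚ of determinant 1 that preserve q and map Λ onto itself. Then Γ acts transitively on the set of primitive isotropic vectors of Λ: for any e, e' ∈ Λ primitive with q(e) = q(e') = 0, there exists γ ∈ Γ with γ·e = e'. -/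
/-- `Λ ⊗ ℚ` for `Λ = ℤ ⊕ ℤ ⊕ ℤᵐ ⊕ ℤ ⊕ ℤ`: coordinates `(a₁, a₂, λ, d₂, d₁)`. -/
abbrev Qv (m : ℕ) : Type := ℚ × ℚ × (Fin m → ℚ) × ℚ × ℚ

/-- The quadratic form `q(a₁,a₂,λ,d₂,d₁) = a₁d₁ + a₂d₂ + q₀(λ)`. -/
def bigQ {m : ℕ} (q₀ : QuadraticForm ℚ (Fin m → ℚ)) (x : Qv m) : ℚ :=
  x.1 * x.2.2.2.2 + x.2.1 * x.2.2.2.1 + q₀ x.2.2.1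

/-- The lattice `Λ = ℤ ⊕ ℤ ⊕ Λ_C ⊕ ℤ ⊕ ℤ` inside `Λ ⊗ ℚ`, as the `ℤ`-span of the
standard basis vectors. -/
def latticeL (m : ℕ) : Submodule ℤ (Qv m) :=
  Submodule.span ℤ
    ({((1 : ℚ), (0 : ℚ), (0 : Fin m → ℚ), (0 : ℚ), (0 : ℚ)),
      ((0 : ℚ), (1 : ℚ), (0 : Fin m → ℚ), (0 : ℚ), (0 : ℚ)),
      ((0 : ℚ), (0 : ℚ), (0 : Fin m → ℚ), (1 : ℚ), (0 : ℚ)),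
      ((0 : ℚ), (0 : ℚ), (0 : Fin m → ℚ), (0 : ℚ), (1 : ℚ))} ∪
      Set.range (fun i : Fin m =>
        ((0 : ℚ), (0 : ℚ), Pi.single i (1 : ℚ), (0 : ℚ), (0 : ℚ))))

/-- The lattice `Λ_C = ℤᵐ` inside `Λ_C ⊗ ℚ = ℚᵐ`. -/
def latticeLC (m : ℕ) : Submodule ℤ (Fin m → ℚ) :=
  Submodule.span ℤ (Set.range fun i : Fin m => (Pi.single i (1 : ℚ) : Fin m → ℚ))

section Transvection

open QuadraticMap

variable {V : Type*} [AddCommGroup V] [Module ℚ V] (Q : QuadraticForm ℚ V)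

/-- `transvectionPart Q f v` is `E - 1`, where `E` is the Eichler transvection attached to an
isotropic vector `f` and a vector `v` orthogonal to `f`. -/
def transvectionPart (f v : V) : V →ₗ[ℚ] V :=
  (Q.polarBilin f).smulRight v - (Q.polarBilin v).smulRight f
    - (Q.polarBilin f).smulRight (Q v • f)

theorem transvectionPart_apply (f v x : V) :
    transvectionPart Q f v x
      = polar Q f x • v - polar Q v x • f - polar Q f x • Q v • f := rfl

variable {Q} {f v : V}

theorem transvectionPart_left (hf : Q f = 0) (hfv : polar Q f v = 0) :
    transvectionPart Q f v f = 0 := by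
  simp [transvectionPart_apply, polar_self, hf, polar_comm Q v f, hfv]

theorem transvectionPart_right (hfv : polar Q f v = 0) :
    transvectionPart Q f v v = -(2 * Q v) • f := by
  simp [transvectionPart_apply, polar_self, hfv]

theorem isNilpotent_transvectionPart (hf : Q f = 0) (hfv : polar Q f v = 0) :
    IsNilpotent (transvectionPart Q f v) := by
  refine ⟨3, LinearMap.ext fun x => ?_⟩
  rw [pow_succ, pow_two, Module.End.mul_apply, Module.End.mul_apply,
    transvectionPart_apply Q f v x]
  simp only [map_sub, map_smul, transvectionPart_left hf hfv, transvectionPart_right hfv]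
  simp

theorem det_one_add_of_isNilpotent [FiniteDimensional ℚ V] {N : V →ₗ[ℚ] V}
    (h : IsNilpotent N) : LinearMap.det (1 + N) = 1 := by
  have := LinearMap.eval_charpoly (-N) 1
  rw [h.neg.charpoly_eq_X_pow_finrank] at this
  simpa using this.symm

theorem map_add_transvectionPart (hf : Q f = 0) (hfv : polar Q f v = 0) (x : V) :
    Q (x + transvectionPart Q f v x) = Q x := by
  have h : transvectionPart Q f v x
      = polar Q f x • v + (-(polar Q v x + polar Q f x * Q v)) • f := by
    rw [transvectionPart_apply]; module
  rw [h, QuadraticMap.map_add Q x, QuadraticMap.map_add Q (_ • v),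
    polar_comm Q x]
  simp only [QuadraticMap.map_smul, polar_add_left, polar_smul_right, polar_smul_left,
    polar_comm Q v f, hf, hfv, smul_eq_mul]
  ring

theorem transvectionPart_neg_add (hf : Q f = 0) (hfv : polar Q f v = 0) (x : V) :
    (x + transvectionPart Q f v x)
      + transvectionPart Q f (-v) (x + transvectionPart Q f v x) = x := by
  simp only [transvectionPart_apply, polar_add_right, polar_sub_right, polar_smul_right,
    polar_neg_left, polar_self, QuadraticMap.map_neg, hf, hfv, polar_comm Q v f, smul_eq_mul]
  module

/-- The Eichler transvection attached to an isotropic vector `f` and a vector `v` orthogonal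
to `f`. -/
def eichler (hf : Q f = 0) (hfv : polar Q f v = 0) : V ≃ₗ[ℚ] V :=
  LinearEquiv.ofLinearMap (1 + transvectionPart Q f v) (1 + transvectionPart Q f (-v))
    (LinearMap.ext fun x => by
      simpa using transvectionPart_neg_add (v := -v) hf (by rw [polar_neg_right, hfv, neg_zero]) x)
    (LinearMap.ext fun x => transvectionPart_neg_add hf hfv x)

/-- Two vectors lie in the same orbit under the determinant-one isometries of `Q` that
stabilize `L`. -/
def SameOrbit (Q : QuadraticForm ℚ V) (L : Submodule ℤ V) (x y : V) : Prop :=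
  ∃ γ : V ≃ₗ[ℚ] V, LinearMap.det (γ : V →ₗ[ℚ] V) = 1 ∧ (∀ x, Q (γ x) = Q x) ∧
    ⇑γ '' (L : Set V) = (L : Set V) ∧ γ x = y

variable {L : Submodule ℤ V}

theorem SameOrbit.refl (x : V) : SameOrbit Q L x x :=
  ⟨LinearEquiv.refl ℚ V, by simp, fun _ => rfl, Set.image_id _, rfl⟩

theorem SameOrbit.symm {x y : V} (h : SameOrbit Q L x y) : SameOrbit Q L y x := by
  obtain ⟨γ, hdet, hQ, hL, rfl⟩ := h
  refine ⟨γ.symm, ?_, fun x => ?_, ?_, γ.symm_apply_apply x⟩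
  · have := LinearEquiv.det_mul_det_symm γ
    rwa [hdet, one_mul] at this
  · rw [← hQ, γ.apply_symm_apply]
  · conv_lhs => rw [← hL]
    exact γ.toEquiv.symm_image_image _

theorem SameOrbit.trans {x y z : V} (h : SameOrbit Q L x y) (h' : SameOrbit Q L y z) :
    SameOrbit Q L x z := by
  obtain ⟨γ, hdet, hQ, hL, rfl⟩ := h
  obtain ⟨δ, hdet', hQ', hL', rfl⟩ := h'
  refine ⟨γ.trans δ, ?_, fun x => ?_, ?_, rfl⟩
  · rw [LinearEquiv.coe_trans, LinearMap.det_comp, hdet, hdet', one_mul]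
  · rw [LinearEquiv.trans_apply, hQ', hQ]
  · rw [show ⇑(γ.trans δ) = ⇑δ ∘ ⇑γ from rfl, Set.image_comp, hL, hL']

theorem SameOrbit.map_eq {x y : V} (h : SameOrbit Q L x y) : Q x = Q y := by
  obtain ⟨γ, -, hQ, -, rfl⟩ := h
  exact (hQ x).symm

theorem transvectionPart_mem (hL : ∀ x ∈ L, ∃ k : ℤ, Q x = k) (hfL : f ∈ L) (hvL : v ∈ L)
    {x : V} (hx : x ∈ L) : transvectionPart Q f v x ∈ L := by
  have hpolar {y z : V} (hy : y ∈ L) (hz : z ∈ L) : ∃ k : ℤ, polar Q y z = k := by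
    obtain ⟨a, ha⟩ := hL _ (add_mem hy hz)
    obtain ⟨b, hb⟩ := hL _ hy
    obtain ⟨c, hc⟩ := hL _ hz
    exact ⟨a - b - c, by rw [polar, ha, hb, hc]; push_cast; rfl⟩
  obtain ⟨a, ha⟩ := hpolar hfL hx
  obtain ⟨b, hb⟩ := hpolar hvL hx
  obtain ⟨c, hc⟩ := hL v hvL
  rw [transvectionPart_apply, ha, hb, hc]
  simp only [Int.cast_smul_eq_zsmul]
  exact sub_mem (sub_mem (L.smul_mem _ hvL) (L.smul_mem _ hfL))
    (L.smul_mem _ (L.smul_mem _ hfL))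

theorem sameOrbit_add_transvectionPart [FiniteDimensional ℚ V]
    (hL : ∀ x ∈ L, ∃ k : ℤ, Q x = k) (hf : Q f = 0) (hfv : polar Q f v = 0)
    (hfL : f ∈ L) (hvL : v ∈ L) (x : V) :
    SameOrbit Q L x (x + transvectionPart Q f v x) := by
  refine ⟨eichler hf hfv, det_one_add_of_isNilpotent (isNilpotent_transvectionPart hf hfv),
    map_add_transvectionPart hf hfv, ?_, rfl⟩
  refine Set.Subset.antisymm ?_ fun y hy => ?_
  · rintro _ ⟨y, hy, rfl⟩
    exact add_mem hy (transvectionPart_mem hL hfL hvL hy)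
  · exact ⟨(eichler hf hfv).symm y,
      add_mem hy (transvectionPart_mem hL hfL (neg_mem hvL) hy),
      (eichler hf hfv).apply_symm_apply y⟩

end Transvection

open QuadraticMap

/-- `bigQ q₀` as a quadratic form. -/
def bigForm {m : ℕ} (q₀ : QuadraticForm ℚ (Fin m → ℚ)) : QuadraticForm ℚ (Qv m) where
  toFun := bigQ q₀
  toFun_smul a x := by
    simp [bigQ, QuadraticMap.map_smul]
    ring
  exists_companion' :=
    ⟨LinearMap.mk₂ ℚ
      (fun x y => x.1 * y.2.2.2.2 + y.1 * x.2.2.2.2 + x.2.1 * y.2.2.2.1 + y.2.1 * x.2.2.2.1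
        + polar q₀ x.2.2.1 y.2.2.1)
      (fun x y z => by simp [polar_add_left]; ring)
      (fun c x y => by simp [polar_smul_left]; ring)
      (fun x y z => by simp [polar_add_right]; ring)
      (fun c x y => by simp [polar_smul_right]; ring), fun x y => by
        simp [bigQ, QuadraticMap.map_add q₀]; ring⟩

variable {m : ℕ} {q₀ : QuadraticForm ℚ (Fin m → ℚ)}

theorem bigForm_apply (x : Qv m) : bigForm q₀ x = bigQ q₀ x := rfl

theorem polar_bigForm (x y : Qv m) :
    polar (bigForm q₀) x y = x.1 * y.2.2.2.2 + y.1 * x.2.2.2.2 + x.2.1 * y.2.2.2.1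
      + y.2.1 * x.2.2.2.1 + polar q₀ x.2.2.1 y.2.2.1 := by
  simp only [polar, bigForm_apply, bigQ, Prod.fst_add, Prod.snd_add]
  ring

/-- The vector of `Λ ⊗ ℚ` with integral hyperbolic coordinates `a₁, a₂, d₂, d₁`. -/
def latticeVec (a₁ a₂ : ℤ) (l : Fin m → ℚ) (d₂ d₁ : ℤ) : Qv m := (a₁, a₂, l, d₂, d₁)

theorem latticeVec_mem (a₁ a₂ d₂ d₁ : ℤ) {l : Fin m → ℚ} (hl : l ∈ latticeLC m) :
    latticeVec a₁ a₂ l d₂ d₁ ∈ latticeL m := by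
  have hl' : ((0, 0, l, 0, 0) : Qv m) ∈ latticeL m := by
    have hle : latticeLC m ≤ (latticeL m).comap
        ((LinearMap.inr ℚ ℚ _ ∘ₗ LinearMap.inr ℚ ℚ _ ∘ₗ
          LinearMap.inl ℚ (Fin m → ℚ) (ℚ × ℚ)).restrictScalars ℤ) := by
      refine Submodule.span_le.2 ?_
      rintro _ ⟨i, rfl⟩
      exact Submodule.subset_span (Or.inr ⟨i, rfl⟩)
    exact hle hl
  have h : latticeVec a₁ a₂ l d₂ d₁ = a₁ • ((1, 0, 0, 0, 0) : Qv m) + a₂ • (0, 1, 0, 0, 0)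
      + d₂ • (0, 0, 0, 1, 0) + d₁ • (0, 0, 0, 0, 1) + (0, 0, l, 0, 0) := by
    simp [latticeVec]
  rw [h]
  refine add_mem (add_mem (add_mem (add_mem ?_ ?_) ?_) ?_) hl' <;>
  exact Submodule.smul_mem _ _ (Submodule.subset_span (Or.inl (by simp)))

theorem exists_eq_latticeVec {x : Qv m} (hx : x ∈ latticeL m) :
    ∃ (a₁ a₂ d₂ d₁ : ℤ) (l : Fin m → ℚ), l ∈ latticeLC m ∧ x = latticeVec a₁ a₂ l d₂ d₁ := by
  induction hx using Submodule.span_induction with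
  | mem x hx =>
    rcases hx with hx | ⟨i, rfl⟩
    · simp only [Set.mem_insert_iff, Set.mem_singleton_iff] at hx
      rcases hx with rfl | rfl | rfl | rfl
      · exact ⟨1, 0, 0, 0, 0, zero_mem _, by simp [latticeVec]⟩
      · exact ⟨0, 1, 0, 0, 0, zero_mem _, by simp [latticeVec]⟩
      · exact ⟨0, 0, 1, 0, 0, zero_mem _, by simp [latticeVec]⟩
      · exact ⟨0, 0, 0, 1, 0, zero_mem _, by simp [latticeVec]⟩
    · exact ⟨0, 0, 0, 0, _, Submodule.subset_span ⟨i, rfl⟩, by simp [latticeVec]⟩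
  | zero => exact ⟨0, 0, 0, 0, 0, zero_mem _, by simp [latticeVec]; rfl⟩
  | add x y _ _ hx hy =>
    obtain ⟨a, b, c, d, l, hl, rfl⟩ := hx
    obtain ⟨a', b', c', d', l', hl', rfl⟩ := hy
    exact ⟨a + a', b + b', c + c', d + d', l + l', add_mem hl hl', by simp [latticeVec]⟩
  | smul k x _ hx =>
    obtain ⟨a, b, c, d, l, hl, rfl⟩ := hx
    exact ⟨k * a, k * b, k * c, k * d, k • l, Submodule.smul_mem _ _ hl, by
      simp [latticeVec]⟩

theorem bigForm_integral (hint : ∀ x ∈ latticeLC m, ∃ k : ℤ, q₀ x = (k : ℚ)) :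
    ∀ x ∈ latticeL m, ∃ k : ℤ, bigForm q₀ x = k := by
  intro x hx
  obtain ⟨a, b, c, d, l, hl, rfl⟩ := exists_eq_latticeVec hx
  obtain ⟨k, hk⟩ := hint l hl
  exact ⟨a * d + b * c + k, by simp [bigForm_apply, bigQ, latticeVec, hk]⟩

theorem polar_integral (hint : ∀ x ∈ latticeLC m, ∃ k : ℤ, q₀ x = (k : ℚ))
    {l μ : Fin m → ℚ} (hl : l ∈ latticeLC m) (hμ : μ ∈ latticeLC m) :
    ∃ k : ℤ, polar q₀ l μ = k := by
  obtain ⟨a, ha⟩ := hint _ (add_mem hl hμ)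
  obtain ⟨b, hb⟩ := hint _ hl
  obtain ⟨c, hc⟩ := hint _ hμ
  exact ⟨a - b - c, by rw [polar, ha, hb, hc]; push_cast; rfl⟩

/-- Two vectors lie in the same orbit under the arithmetic group of `Λ`. -/
abbrev LatticeOrbit (q₀ : QuadraticForm ℚ (Fin m → ℚ)) (x y : Qv m) : Prop :=
  SameOrbit (bigForm q₀) (latticeL m) x y

section Moves

variable (hint : ∀ x ∈ latticeLC m, ∃ k : ℤ, q₀ x = (k : ℚ))
include hint

theorem latticeOrbit_of_transvection {a₁ a₂ d₂ d₁ : ℤ} {l : Fin m → ℚ}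
    {f v y : Qv m} (hfL : f ∈ latticeL m) (hvL : v ∈ latticeL m)
    (hf : bigQ q₀ f = 0) (hfv : polar (bigForm q₀) f v = 0)
    (hy : latticeVec a₁ a₂ l d₂ d₁
      + transvectionPart (bigForm q₀) f v (latticeVec a₁ a₂ l d₂ d₁) = y) :
    LatticeOrbit q₀ (latticeVec a₁ a₂ l d₂ d₁) y :=
  hy ▸ sameOrbit_add_transvectionPart (bigForm_integral hint) hf hfv hfL hvL _

theorem latticeOrbit_add_a₂_sub_d₁ (a₁ a₂ d₂ d₁ c : ℤ) (l : Fin m → ℚ) :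
    LatticeOrbit q₀ (latticeVec a₁ a₂ l d₂ d₁)
      (latticeVec a₁ (a₂ + c * a₁) l d₂ (d₁ - c * d₂)) := by
  refine latticeOrbit_of_transvection hint (f := latticeVec 0 1 0 0 0)
    (v := latticeVec 0 0 0 0 (-c)) (latticeVec_mem _ _ _ _ (zero_mem _))
    (latticeVec_mem _ _ _ _ (zero_mem _)) (by simp [bigQ, latticeVec])
    (by simp [polar_bigForm, latticeVec]) ?_
  simp [transvectionPart_apply, polar_bigForm, bigForm_apply, bigQ, latticeVec]
  ring_nf
  simp

theorem latticeOrbit_add_d₂_sub_d₁ (a₁ a₂ d₂ d₁ c : ℤ) (l : Fin m → ℚ) :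
    LatticeOrbit q₀ (latticeVec a₁ a₂ l d₂ d₁)
      (latticeVec a₁ a₂ l (d₂ + c * a₁) (d₁ - c * a₂)) := by
  refine latticeOrbit_of_transvection hint (f := latticeVec 0 0 0 1 0)
    (v := latticeVec 0 0 0 0 (-c)) (latticeVec_mem _ _ _ _ (zero_mem _))
    (latticeVec_mem _ _ _ _ (zero_mem _)) (by simp [bigQ, latticeVec])
    (by simp [polar_bigForm, latticeVec]) ?_
  simp [transvectionPart_apply, polar_bigForm, bigForm_apply, bigQ, latticeVec]
  ring_nf
  simp

theorem latticeOrbit_add_a₁_sub_a₂ (a₁ a₂ d₂ d₁ c : ℤ) (l : Fin m → ℚ) :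
    LatticeOrbit q₀ (latticeVec a₁ a₂ l d₂ d₁)
      (latticeVec (a₁ + c * d₂) (a₂ - c * d₁) l d₂ d₁) := by
  refine latticeOrbit_of_transvection hint (f := latticeVec 0 1 0 0 0)
    (v := latticeVec c 0 0 0 0) (latticeVec_mem _ _ _ _ (zero_mem _))
    (latticeVec_mem _ _ _ _ (zero_mem _)) (by simp [bigQ, latticeVec])
    (by simp [polar_bigForm, latticeVec]) ?_
  simp [transvectionPart_apply, polar_bigForm, bigForm_apply, bigQ, latticeVec]
  ring_nf
  simp

theorem latticeOrbit_add_a₁_sub_d₂ (a₁ a₂ d₂ d₁ c : ℤ) (l : Fin m → ℚ) :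
    LatticeOrbit q₀ (latticeVec a₁ a₂ l d₂ d₁)
      (latticeVec (a₁ + c * a₂) a₂ l (d₂ - c * d₁) d₁) := by
  refine latticeOrbit_of_transvection hint (f := latticeVec 0 0 0 1 0)
    (v := latticeVec c 0 0 0 0) (latticeVec_mem _ _ _ _ (zero_mem _))
    (latticeVec_mem _ _ _ _ (zero_mem _)) (by simp [bigQ, latticeVec])
    (by simp [polar_bigForm, latticeVec]) ?_
  simp [transvectionPart_apply, polar_bigForm, bigForm_apply, bigQ, latticeVec]
  ring_nf
  simp

theorem latticeOrbit_translate_a₂ (a₁ a₂ d₂ d₁ : ℤ) (l : Fin m → ℚ) {μ : Fin m → ℚ} {k n : ℤ}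
    (hμ : μ ∈ latticeLC m) (hk : polar q₀ μ l = k) (hn : q₀ μ = n) :
    LatticeOrbit q₀ (latticeVec a₁ a₂ l d₂ d₁)
      (latticeVec a₁ (a₂ - k - n * d₂) (l + d₂ • μ) d₂ d₁) := by
  refine latticeOrbit_of_transvection hint (f := latticeVec 0 1 0 0 0)
    (v := latticeVec 0 0 μ 0 0) (latticeVec_mem _ _ _ _ (zero_mem _))
    (latticeVec_mem _ _ _ _ hμ) (by simp [bigQ, latticeVec])
    (by simp [polar_bigForm, latticeVec]) ?_
  simp [transvectionPart_apply, polar_bigForm, bigForm_apply, bigQ, latticeVec, hk, hn]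
  ring_nf
  simp
  ext i
  simp [mul_comm]

theorem latticeOrbit_translate_d₁ (a₁ a₂ d₂ d₁ : ℤ) (l : Fin m → ℚ) {μ : Fin m → ℚ} {k n : ℤ}
    (hμ : μ ∈ latticeLC m) (hk : polar q₀ μ l = k) (hn : q₀ μ = n) :
    LatticeOrbit q₀ (latticeVec a₁ a₂ l d₂ d₁)
      (latticeVec a₁ a₂ (l + a₁ • μ) d₂ (d₁ - k - n * a₁)) := by
  refine latticeOrbit_of_transvection hint (f := latticeVec 0 0 0 0 1)
    (v := latticeVec 0 0 μ 0 0) (latticeVec_mem _ _ _ _ (zero_mem _))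
    (latticeVec_mem _ _ _ _ hμ) (by simp [bigQ, latticeVec])
    (by simp [polar_bigForm, latticeVec]) ?_
  simp [transvectionPart_apply, polar_bigForm, bigForm_apply, bigQ, latticeVec, hk, hn]
  ring_nf
  simp
  ext i
  simp [mul_comm]

theorem latticeOrbit_rotate_a₂ (a₁ a₂ d₂ d₁ : ℤ) (l : Fin m → ℚ) :
    LatticeOrbit q₀ (latticeVec a₁ a₂ l d₂ d₁) (latticeVec a₂ (-a₁) l (-d₁) d₂) := by
  refine (latticeOrbit_add_a₁_sub_d₂ hint _ _ _ _ 1 _).trans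
    ((latticeOrbit_add_a₂_sub_d₁ hint _ _ _ _ (-1) _).trans ?_)
  convert latticeOrbit_add_a₁_sub_d₂ hint _ _ _ _ 1 _ using 2 <;> ring

theorem latticeOrbit_rotate_d₂ (a₁ a₂ d₂ d₁ : ℤ) (l : Fin m → ℚ) :
    LatticeOrbit q₀ (latticeVec a₁ a₂ l d₂ d₁) (latticeVec d₂ (-d₁) l (-a₁) a₂) := by
  refine (latticeOrbit_add_a₁_sub_a₂ hint _ _ _ _ 1 _).trans
    ((latticeOrbit_add_d₂_sub_d₁ hint _ _ _ _ (-1) _).trans ?_)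
  convert latticeOrbit_add_a₁_sub_a₂ hint _ _ _ _ 1 _ using 2 <;> ring

theorem latticeOrbit_neg (a₁ a₂ d₂ d₁ : ℤ) (l : Fin m → ℚ) :
    LatticeOrbit q₀ (latticeVec a₁ a₂ l d₂ d₁) (latticeVec (-a₁) (-a₂) l (-d₂) (-d₁)) :=
  (latticeOrbit_rotate_a₂ hint _ _ _ _ _).trans (latticeOrbit_rotate_a₂ hint _ _ _ _ _)

theorem exists_latticeOrbit_ne_zero (hneg : ∀ x : Fin m → ℚ, x ≠ 0 → q₀ x < 0)
    {a₁ a₂ d₂ d₁ : ℤ} {l : Fin m → ℚ} (hne : latticeVec a₁ a₂ l d₂ d₁ ≠ 0)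
    (hiso : bigQ q₀ (latticeVec a₁ a₂ l d₂ d₁) = 0) :
    ∃ b₁ b₂ c₂ c₁ : ℤ, b₁ ≠ 0 ∧
      LatticeOrbit q₀ (latticeVec a₁ a₂ l d₂ d₁) (latticeVec b₁ b₂ l c₂ c₁) := by
  by_cases h₁ : a₁ = 0
  · by_cases h₂ : a₂ = 0
    · by_cases h₃ : d₂ = 0
      · by_cases h₄ : d₁ = 0
        · subst h₁ h₂ h₃ h₄
          refine (hne ?_).elim
          have hl : l = 0 := by
            by_contra hl
            exact (hneg l hl).ne (by simpa [bigQ, latticeVec] using hiso)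
          simp [latticeVec, hl]
        · exact ⟨_, _, _, _, neg_ne_zero.2 h₄, (latticeOrbit_rotate_a₂ hint _ _ _ _ _).trans
            (latticeOrbit_rotate_d₂ hint _ _ _ _ _)⟩
      · exact ⟨_, _, _, _, h₃, latticeOrbit_rotate_d₂ hint _ _ _ _ _⟩
    · exact ⟨_, _, _, _, h₂, latticeOrbit_rotate_a₂ hint _ _ _ _ _⟩
  · exact ⟨_, _, _, _, h₁, SameOrbit.refl _⟩

theorem latticeOrbit_of_isotropic (a₂ d₂ d₁ : ℤ) {l : Fin m → ℚ} (hl : l ∈ latticeLC m)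
    (hiso : bigQ q₀ (latticeVec 1 a₂ l d₂ d₁) = 0) :
    LatticeOrbit q₀ (latticeVec 1 a₂ l d₂ d₁) (latticeVec 1 0 0 0 0) := by
  obtain ⟨n, hn⟩ := hint _ (neg_mem hl)
  obtain ⟨k, hk⟩ := polar_integral hint (neg_mem hl) hl
  have h := ((latticeOrbit_translate_d₁ hint 1 a₂ d₂ d₁ l (neg_mem hl) hk hn).trans
    (latticeOrbit_add_a₂_sub_d₁ hint _ _ _ _ (-a₂) _)).trans
    (latticeOrbit_add_d₂_sub_d₁ hint _ _ _ _ (-d₂) _)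
  simp only [mul_one, add_neg_cancel, one_smul] at h
  generalize d₁ - k - n - -a₂ * d₂ - -d₂ * 0 = c at h
  have hc : c = 0 := by
    have := h.map_eq
    rw [bigForm_apply, hiso] at this
    simpa [bigForm_apply, bigQ, latticeVec] using this.symm
  rwa [hc] at h

end Moves

/-- The first coordinate of `x` is nonzero and of minimal absolute value in the orbit of `x`. -/
def IsOrbitMinimal (q₀ : QuadraticForm ℚ (Fin m → ℚ)) (a₁ a₂ : ℤ) (l : Fin m → ℚ) (d₂ d₁ : ℤ) :
    Prop :=
  a₁ ≠ 0 ∧ ∀ (b₁ b₂ c₂ c₁ : ℤ) (μ : Fin m → ℚ), μ ∈ latticeLC m → b₁ ≠ 0 →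
    LatticeOrbit q₀ (latticeVec a₁ a₂ l d₂ d₁) (latticeVec b₁ b₂ μ c₂ c₁) → |a₁| ≤ |b₁|

theorem IsOrbitMinimal.of_latticeOrbit {a₁ a₂ d₂ d₁ b₂ c₂ c₁ : ℤ} {l μ : Fin m → ℚ}
    (h : IsOrbitMinimal q₀ a₁ a₂ l d₂ d₁)
    (h' : LatticeOrbit q₀ (latticeVec a₁ a₂ l d₂ d₁) (latticeVec a₁ b₂ μ c₂ c₁)) :
    IsOrbitMinimal q₀ a₁ b₂ μ c₂ c₁ :=
  ⟨h.1, fun _ _ _ _ _ hν hb hR => h.2 _ _ _ _ _ hν hb (h'.trans hR)⟩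

theorem exists_isOrbitMinimal {a₁ a₂ d₂ d₁ : ℤ} {l : Fin m → ℚ} (hl : l ∈ latticeLC m)
    (ha : a₁ ≠ 0) :
    ∃ (b₁ b₂ c₂ c₁ : ℤ) (μ : Fin m → ℚ), μ ∈ latticeLC m ∧
      LatticeOrbit q₀ (latticeVec a₁ a₂ l d₂ d₁) (latticeVec b₁ b₂ μ c₂ c₁) ∧
      IsOrbitMinimal q₀ b₁ b₂ μ c₂ c₁ := by
  classical
  have hex : ∃ n : ℕ, ∃ (b₁ b₂ c₂ c₁ : ℤ) (μ : Fin m → ℚ), μ ∈ latticeLC m ∧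
      LatticeOrbit q₀ (latticeVec a₁ a₂ l d₂ d₁) (latticeVec b₁ b₂ μ c₂ c₁) ∧
      b₁ ≠ 0 ∧ b₁.natAbs = n :=
    ⟨_, a₁, a₂, d₂, d₁, l, hl, SameOrbit.refl _, ha, rfl⟩
  obtain ⟨b₁, b₂, c₂, c₁, μ, hμ, hR, hb, hmin⟩ := Nat.find_spec hex
  refine ⟨b₁, b₂, c₂, c₁, μ, hμ, hR, hb, fun b₁' b₂' c₂' c₁' ν hν hb' hR' => ?_⟩
  have := Nat.find_min' hex ⟨b₁', b₂', c₂', c₁', ν, hν, hR.trans hR', hb', rfl⟩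
  rw [← hmin] at this
  rw [Int.abs_eq_natAbs, Int.abs_eq_natAbs]
  exact_mod_cast this

section OrbitMinimal

variable (hint : ∀ x ∈ latticeLC m, ∃ k : ℤ, q₀ x = (k : ℚ))
include hint
variable {a₁ a₂ d₂ d₁ : ℤ} {l : Fin m → ℚ}

theorem IsOrbitMinimal.dvd_a₂ (h : IsOrbitMinimal q₀ a₁ a₂ l d₂ d₁) (hl : l ∈ latticeLC m) :
    a₁ ∣ a₂ := by
  by_contra hdvd
  have hR := (latticeOrbit_add_a₂_sub_d₁ hint a₁ a₂ d₂ d₁ (-(a₂ / a₁)) l).trans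
    (latticeOrbit_rotate_a₂ hint _ _ _ _ _)
  have hmod : a₂ + -(a₂ / a₁) * a₁ = a₂ % a₁ := by
    rw [Int.emod_def]; ring
  rw [hmod] at hR
  have hle := h.2 _ _ _ _ _ hl (fun h0 => hdvd (Int.dvd_of_emod_eq_zero h0)) hR
  rw [abs_of_nonneg (Int.emod_nonneg _ h.1)] at hle
  exact absurd (Int.emod_lt_abs a₂ h.1) hle.not_gt

theorem IsOrbitMinimal.dvd_d₂ (h : IsOrbitMinimal q₀ a₁ a₂ l d₂ d₁) (hl : l ∈ latticeLC m) :
    a₁ ∣ d₂ := by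
  by_contra hdvd
  have hR := (latticeOrbit_add_d₂_sub_d₁ hint a₁ a₂ d₂ d₁ (-(d₂ / a₁)) l).trans
    (latticeOrbit_rotate_d₂ hint _ _ _ _ _)
  have hmod : d₂ + -(d₂ / a₁) * a₁ = d₂ % a₁ := by
    rw [Int.emod_def]; ring
  rw [hmod] at hR
  have hle := h.2 _ _ _ _ _ hl (fun h0 => hdvd (Int.dvd_of_emod_eq_zero h0)) hR
  rw [abs_of_nonneg (Int.emod_nonneg _ h.1)] at hle
  exact absurd (Int.emod_lt_abs d₂ h.1) hle.not_gt

theorem IsOrbitMinimal.dvd_d₁ (h : IsOrbitMinimal q₀ a₁ a₂ l d₂ d₁) (hl : l ∈ latticeLC m) :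
    a₁ ∣ d₁ := by
  obtain ⟨c, rfl⟩ := h.dvd_d₂ hint hl
  obtain ⟨b, rfl⟩ := h.dvd_a₂ hint hl
  have hR := latticeOrbit_add_d₂_sub_d₁ hint a₁ (a₁ * b) (a₁ * c) d₁ (-c) l
  rw [show a₁ * c + -c * a₁ = 0 by ring] at hR
  have hR' := hR.trans (latticeOrbit_add_a₁_sub_a₂ hint _ _ _ _ 1 _)
  rw [mul_zero, add_zero] at hR'
  have hdvd := (h.of_latticeOrbit hR').dvd_a₂ hint hl
  have : d₁ = a₁ * b - (a₁ * b - 1 * (d₁ - -c * (a₁ * b))) - c * (a₁ * b) := by ring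
  rw [this]
  exact dvd_sub (dvd_sub (dvd_mul_right _ _) hdvd) (Dvd.intro _ (by ring : a₁ * (c * b) = _))

theorem IsOrbitMinimal.dvd_polar (h : IsOrbitMinimal q₀ a₁ a₂ l d₂ d₁) (hl : l ∈ latticeLC m)
    {μ : Fin m → ℚ} (hμ : μ ∈ latticeLC m) : ∃ k : ℤ, polar q₀ μ l = a₁ * k := by
  obtain ⟨k, hk⟩ := polar_integral hint hμ hl
  obtain ⟨n, hn⟩ := hint _ hμ
  have hR := latticeOrbit_translate_a₂ hint a₁ a₂ d₂ d₁ l hμ hk hn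
  have hdvd := (h.of_latticeOrbit hR).dvd_a₂ hint
    (add_mem hl (Submodule.smul_mem _ _ hμ))
  have : k = a₂ - (a₂ - k - n * d₂) - n * d₂ := by ring
  obtain ⟨j, hj⟩ : a₁ ∣ k := by
    rw [this]
    exact dvd_sub (dvd_sub (h.dvd_a₂ hint hl) hdvd) ((h.dvd_d₂ hint hl).mul_left _)
  exact ⟨j, by rw [hk, hj]; push_cast; rfl⟩

theorem IsOrbitMinimal.inv_smul_mem
    (hmax : ∀ Λ₁ : Submodule ℤ (Fin m → ℚ), Λ₁.FG → latticeLC m ≤ Λ₁ →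
      (∀ x ∈ Λ₁, ∃ k : ℤ, q₀ x = (k : ℚ)) → Λ₁ = latticeLC m)
    (h : IsOrbitMinimal q₀ a₁ a₂ l d₂ d₁) (hl : l ∈ latticeLC m)
    (hiso : bigQ q₀ (latticeVec a₁ a₂ l d₂ d₁) = 0) :
    (a₁ : ℚ)⁻¹ • l ∈ latticeLC m := by
  have ha : (a₁ : ℚ) ≠ 0 := Int.cast_ne_zero.2 h.1
  obtain ⟨b₂, hb₂⟩ := h.dvd_a₂ hint hl
  obtain ⟨c₂, hc₂⟩ := h.dvd_d₂ hint hl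
  obtain ⟨c₁, hc₁⟩ := h.dvd_d₁ hint hl
  set ν := (a₁ : ℚ)⁻¹ • l with hν
  have hqν : q₀ ν = -(c₁ + b₂ * c₂ : ℤ) := by
    have hq : q₀ l = -(a₁ * d₁ + a₂ * d₂) := by
      simp only [bigQ, latticeVec] at hiso
      linarith
    rw [hν, QuadraticMap.map_smul, hq, hb₂, hc₂, hc₁, smul_eq_mul]
    push_cast
    field_simp
  rw [← hmax (latticeLC m ⊔ Submodule.span ℤ {ν}) ?_ le_sup_left ?_]
  · exact Submodule.mem_sup_right (Submodule.mem_span_singleton_self ν)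
  · exact Submodule.FG.sup (Submodule.fg_span (Set.finite_range _))
      (Submodule.fg_span_singleton ν)
  · intro x hx
    obtain ⟨μ, hμ, y, hy, rfl⟩ := Submodule.mem_sup.1 hx
    obtain ⟨j, rfl⟩ := Submodule.mem_span_singleton.1 hy
    obtain ⟨n, hn⟩ := hint _ hμ
    obtain ⟨k, hk⟩ := h.dvd_polar hint hl hμ
    refine ⟨n + j * j * -(c₁ + b₂ * c₂) + j * k, ?_⟩
    rw [← Int.cast_smul_eq_zsmul ℚ, QuadraticMap.map_add q₀, QuadraticMap.map_smul, hn, hqν,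
      polar_smul_right, hν, polar_smul_right, hk]
    simp only [smul_eq_mul]
    push_cast
    field_simp

end OrbitMinimal

theorem latticeOrbit_of_primitive (hneg : ∀ x : Fin m → ℚ, x ≠ 0 → q₀ x < 0)
    (hint : ∀ x ∈ latticeLC m, ∃ k : ℤ, q₀ x = (k : ℚ))
    (hmax : ∀ Λ₁ : Submodule ℤ (Fin m → ℚ), Λ₁.FG → latticeLC m ≤ Λ₁ →
      (∀ x ∈ Λ₁, ∃ k : ℤ, q₀ x = (k : ℚ)) → Λ₁ = latticeLC m)
    {e : Qv m} (he : e ∈ latticeL m) (hne : e ≠ 0)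
    (hprim : ∀ (k : ℤ) (f : Qv m), f ∈ latticeL m → e = k • f → k = 1 ∨ k = -1)
    (hiso : bigQ q₀ e = 0) :
    LatticeOrbit q₀ e (latticeVec 1 0 0 0 0) := by
  obtain ⟨a₁, a₂, d₂, d₁, l, hl, rfl⟩ := exists_eq_latticeVec he
  obtain ⟨b₁, b₂, c₂, c₁, hb, hR₁⟩ := exists_latticeOrbit_ne_zero hint hneg hne hiso
  obtain ⟨g, g₂, h₂, h₁, μ, hμ, hR₂, hred⟩ :=
    exists_isOrbitMinimal (q₀ := q₀) (a₂ := b₂) (d₂ := c₂) (d₁ := c₁) hl hb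
  have hR := hR₁.trans hR₂
  have hiso' : bigQ q₀ (latticeVec g g₂ μ h₂ h₁) = 0 := hR.map_eq.symm.trans hiso
  have hmem := hred.inv_smul_mem hint hmax hμ hiso'
  have hg : g = 1 ∨ g = -1 := by
    obtain ⟨k₂, hk₂⟩ := hred.dvd_a₂ hint hμ
    obtain ⟨j₂, hj₂⟩ := hred.dvd_d₂ hint hμ
    obtain ⟨j₁, hj₁⟩ := hred.dvd_d₁ hint hμ
    have hvec : latticeVec g g₂ μ h₂ h₁
        = g • latticeVec 1 k₂ ((g : ℚ)⁻¹ • μ) j₂ j₁ := by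
      have : (g : ℚ) ≠ 0 := Int.cast_ne_zero.2 hred.1
      have hμg : g • (g : ℚ)⁻¹ • μ = μ := by
        rw [← Int.cast_smul_eq_zsmul ℚ, smul_inv_smul₀ this]
      simp [latticeVec, hμg, hk₂, hj₂, hj₁]
    obtain ⟨γ, -, -, hL, hγ⟩ := hR.symm
    refine hprim g (γ (latticeVec 1 k₂ ((g : ℚ)⁻¹ • μ) j₂ j₁)) ?_ ?_
    · exact hL.subset ⟨_, latticeVec_mem _ _ _ _ hmem, rfl⟩
    · rw [← hγ, hvec, map_zsmul]
  rcases hg with rfl | rfl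
  · exact hR.trans (latticeOrbit_of_isotropic hint _ _ _ hμ hiso')
  · have hN := hR.trans (latticeOrbit_neg hint _ _ _ _ _)
    rw [neg_neg] at hN
    exact hN.trans (latticeOrbit_of_isotropic hint _ _ _ hμ (hN.map_eq.symm.trans hiso))

/-- If `q₀` is a negative-definite integral quadratic form on the maximal lattice `Λ_C`, then
the group `Γ` of determinant-one `ℚ`-linear automorphisms preserving `q` and the lattice `Λ`
acts transitively on primitive isotropic vectors of `Λ = ℤ ⊕ ℤ ⊕ Λ_C ⊕ ℤ ⊕ ℤ` with
`q(a₁,a₂,λ,d₂,d₁) = a₁d₁ + a₂d₂ + q₀(λ)`. -/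
theorem stmt13 (m : ℕ) (q₀ : QuadraticForm ℚ (Fin m → ℚ))
    (hneg : ∀ x : Fin m → ℚ, x ≠ 0 → q₀ x < 0)
    (hint : ∀ x ∈ latticeLC m, ∃ k : ℤ, q₀ x = (k : ℚ))
    (hmax : ∀ Λ₁ : Submodule ℤ (Fin m → ℚ), Λ₁.FG → latticeLC m ≤ Λ₁ →
      (∀ x ∈ Λ₁, ∃ k : ℤ, q₀ x = (k : ℚ)) → Λ₁ = latticeLC m)
    (e e' : Qv m) (he : e ∈ latticeL m) (he' : e' ∈ latticeL m)
    (hne : e ≠ 0) (hne' : e' ≠ 0)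
    (hprim : ∀ (k : ℤ) (f : Qv m), f ∈ latticeL m → e = k • f → k = 1 ∨ k = -1)
    (hprim' : ∀ (k : ℤ) (f : Qv m), f ∈ latticeL m → e' = k • f → k = 1 ∨ k = -1)
    (hiso : bigQ q₀ e = 0) (hiso' : bigQ q₀ e' = 0) :
    ∃ γ : Qv m ≃ₗ[ℚ] Qv m,
      LinearMap.det (γ : Qv m →ₗ[ℚ] Qv m) = 1 ∧
      (∀ x, bigQ q₀ (γ x) = bigQ q₀ x) ∧
      ⇑γ '' (latticeL m : Set (Qv m)) = (latticeL m : Set (Qv m)) ∧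
      γ e = e' := by
  exact (latticeOrbit_of_primitive hneg hint hmax he hne hprim hiso).trans
    (latticeOrbit_of_primitive hneg hint hmax he' hne' hprim' hiso').symm
end
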